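/- For any (w,p,h)-datum, the linear map from E⁺ ⊕ H⁻ to E⁻ ⊕ H⁺ sending (x, η), with x ∈ Eⁱ for i even and η ∈ Hʲ for j odd, to (v_i x + w_i x + h_j η, p_i x) — that is, the map v⁺ + w⁺ + p⁺ + h⁻ : E⁺ ⊕ H⁻ → E⁻ ⊕ H⁺ — is a linear isomorphism. -/

import Mathlib

variable {E : ℕ → Type*} [∀ i, AddCommGroup (E i)] [∀ i, Module ℂ (E i)]

/-- The boundary submodule `im v_{i-1}` viewed inside `ker v_i` (zero for `i = 0`,
following the convention `v_0 = 0`, i.e. `E⁰ = 0`). -/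
def bdry (v : ∀ i, E i →ₗ[ℂ] E (i + 1)) : ∀ i, Submodule ℂ ↥(LinearMap.ker (v i))
  | 0 => ⊥
  | (i + 1) => Submodule.comap (LinearMap.ker (v (i + 1))).subtype (LinearMap.range (v i))

/-- The cohomology `Hⁱ = ker v_i / im v_{i−1}` of the complex `v`. -/
def Hcoh (v : ∀ i, E i →ₗ[ℂ] E (i + 1)) (i : ℕ) : Type _ :=
  ↥(LinearMap.ker (v i)) ⧸ bdry v i

instance (v : ∀ i, E i →ₗ[ℂ] E (i + 1)) (i : ℕ) : AddCommGroup (Hcoh v i) :=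
  inferInstanceAs (AddCommGroup (↥(LinearMap.ker (v i)) ⧸ bdry v i))

instance (v : ∀ i, E i →ₗ[ℂ] E (i + 1)) (i : ℕ) : Module ℂ (Hcoh v i) :=
  inferInstanceAs (Module ℂ (↥(LinearMap.ker (v i)) ⧸ bdry v i))

/-- The canonical quotient map `ker v_i → Hⁱ`. -/
def cohQuot (v : ∀ i, E i →ₗ[ℂ] E (i + 1)) (i : ℕ) :
    ↥(LinearMap.ker (v i)) →ₗ[ℂ] Hcoh v i :=
  (bdry v i).mkQ

/-- A relation that can be solved backwards at each step has a global solution, provided the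
types are eventually trivial. -/
theorem exists_forall_rel_succ_of_eventually_unique (N : ℕ) :
    ∀ {X : ℕ → Type*} (R : ∀ j, X j → X (j + 1) → Prop),
      (∀ j x', ∃ x, R j x x') → (∀ j, N ≤ j → Subsingleton (X j) ∧ Nonempty (X j)) →
      ∃ x : ∀ j, X j, ∀ j, R j (x j) (x (j + 1)) := by
  induction N with
  | zero =>
    intro X R hR hX
    refine ⟨fun j => (hX j j.zero_le).2.some, fun j => ?_⟩
    obtain ⟨x, hx⟩ := hR j (hX (j + 1) (Nat.zero_le _)).2.some
    have := (hX j j.zero_le).1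
    rwa [Subsingleton.elim x (hX j j.zero_le).2.some] at hx
  | succ N ih =>
    intro X R hR hX
    obtain ⟨x, hx⟩ := ih (X := fun j => X (j + 1)) (fun j => R (j + 1))
      (fun j => hR (j + 1)) (fun j hj => hX (j + 1) (by omega))
    obtain ⟨x₀, hx₀⟩ := hR 0 (x 0)
    refine ⟨fun j => Nat.casesOn j x₀ x, fun j => ?_⟩
    cases j with
    | zero => exact hx₀
    | succ j => exact hx j

theorem cohQuot_succ_eq_zero_iff (v : ∀ i, E i →ₗ[ℂ] E (i + 1)) (i : ℕ)
    (x : ↥(LinearMap.ker (v (i + 1)))) :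
    cohQuot v (i + 1) x = 0 ↔ ∃ y, v i y = x := by
  have : cohQuot v (i + 1) x = 0 ↔ x ∈ bdry v (i + 1) := Submodule.Quotient.mk_eq_zero _
  rw [this]
  rfl

/-- A cocycle in positive degree is killed by `p` iff it is a coboundary. -/
theorem apply_eq_zero_iff_exists_of_cocycle (v : ∀ i, E i →ₗ[ℂ] E (i + 1))
    (p : ∀ i, E i →ₗ[ℂ] Hcoh v i)
    (hp : ∀ i (x : ↥(LinearMap.ker (v i))), p i (x : E i) = cohQuot v i x)
    (i : ℕ) (x : E (i + 1)) (hx : v (i + 1) x = 0) :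
    p (i + 1) x = 0 ↔ ∃ y, v i y = x := by
  rw [← cohQuot_succ_eq_zero_iff v i ⟨x, hx⟩, ← hp]

/-- The map `v⁺ + w⁺ + p⁺ + h⁻ : E⁺ ⊕ H⁻ → E⁻ ⊕ H⁺`. -/
def wphMap (v : ∀ i, E i →ₗ[ℂ] E (i + 1)) (w : ∀ i, E (i + 1) →ₗ[ℂ] E i)
    (p : ∀ i, E i →ₗ[ℂ] Hcoh v i) (h : ∀ i, Hcoh v i →ₗ[ℂ] E i) :
    ((∀ j : ℕ, E (2 * j)) × (∀ j : ℕ, Hcoh v (2 * j + 1))) →ₗ[ℂ]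
      ((∀ j : ℕ, E (2 * j + 1)) × (∀ j : ℕ, Hcoh v (2 * j))) where
  toFun z :=
    (fun j => v (2 * j) (z.1 j) + w (2 * j + 1) (z.1 (j + 1)) + h (2 * j + 1) (z.2 j),
      fun j => p (2 * j) (z.1 j))
  map_add' a b := by
    refine Prod.ext (funext fun j => ?_) (funext fun j => ?_)
    · simp only [Prod.fst_add, Prod.snd_add, Pi.add_apply]
      rw [map_add, map_add, map_add]
      abel
    · exact map_add (p (2 * j)) _ _
  map_smul' c a := by
    refine Prod.ext (funext fun j => ?_) (funext fun j => ?_)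
    · simp only [Prod.smul_fst, Prod.smul_snd, Pi.smul_apply, RingHom.id_apply]
      rw [map_smul, map_smul, map_smul, smul_add, smul_add]
    · exact map_smul (p (2 * j)) _ _

section

variable (v : ∀ i, E i →ₗ[ℂ] E (i + 1)) (w : ∀ i, E (i + 1) →ₗ[ℂ] E i)
  (p : ∀ i, E i →ₗ[ℂ] Hcoh v i) (h : ∀ i, Hcoh v i →ₗ[ℂ] E i)

theorem wphMap_injective (k : ℕ) (h0 : Subsingleton (E 0))
    (htop : ∀ i, k + 1 ≤ i → Subsingleton (E i))
    (hv : ∀ i, v (i + 1) ∘ₗ v i = 0)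
    (hw : ∀ i (x : E i), v i (w i (v i x)) = v i x)
    (hp : ∀ i (x : ↥(LinearMap.ker (v i))), p i (x : E i) = cohQuot v i x)
    (him : ∀ i (η : Hcoh v i), v i (h i η) = 0)
    (hph : ∀ i (η : Hcoh v i), p i (h i η) = η) :
    Function.Injective (wphMap v w p h) := by
  have hvv : ∀ i (x : E i), v (i + 1) (v i x) = 0 := fun i x => LinearMap.congr_fun (hv i) x
  have hpv : ∀ i (x : E i), p (i + 1) (v i x) = 0 := fun i x =>
    (apply_eq_zero_iff_exists_of_cocycle v p hp i _ (hvv i x)).2 ⟨x, rfl⟩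
  rw [injective_iff_map_eq_zero]
  rintro ⟨x, η⟩ hz
  have hE : ∀ j, v (2 * j) (x j) + w (2 * j + 1) (x (j + 1)) + h (2 * j + 1) (η j) = 0 :=
    fun j => congrFun (congrArg Prod.fst hz) j
  have hH : ∀ j, p (2 * j) (x j) = 0 := fun j => congrFun (congrArg Prod.snd hz) j
  have hvw : ∀ j, v (2 * j + 1) (w (2 * j + 1) (x (j + 1))) = 0 := fun j => by
    simpa [hvv, him] using congrArg (v (2 * j + 1)) (hE j)
  have key : ∀ j, x (j + 1) = 0 → η j = 0 ∧ v (2 * j) (x j) = 0 := fun j hj => by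
    have e := hE j
    rw [hj, map_zero, add_zero] at e
    have hη : η j = 0 := by simpa [hpv, hph] using congrArg (p (2 * j + 1)) e
    rw [hη, map_zero, add_zero] at e
    exact ⟨hη, e⟩
  have step : ∀ j, x (j + 1) = 0 → x j = 0 := fun j hj => by
    have hvx := (key j hj).2
    cases j with
    | zero => exact Subsingleton.elim (α := E 0) _ _
    | succ j =>
      obtain ⟨y, hy⟩ :=
        (apply_eq_zero_iff_exists_of_cocycle v p hp (2 * j + 1) (x (j + 1)) hvx).1 (hH (j + 1))
      have := hvw j
      rw [← hy, hw, hy] at this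
      exact this
  have hx : ∀ n j, k + 1 ≤ j + n → x j = 0 := fun n => by
    induction n with
    | zero =>
      intro j hj
      have := htop (2 * j) (by omega)
      exact Subsingleton.elim _ _
    | succ n ih => exact fun j hj => step j (ih (j + 1) (by omega))
  have hx' : ∀ j, x j = 0 := fun j => hx (k + 1) j (by omega)
  exact Prod.ext (funext hx') (funext fun j => (key j (hx' (j + 1))).1)

/-- The condition on the component of a preimage in degree `2 * j` which makes the component in
degree `2 * j - 2` solvable for. -/
def WphCompatible (y : ∀ j : ℕ, E (2 * j + 1)) : ∀ j : ℕ, E (2 * j) → Prop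
  | 0, _ => True
  | j + 1, x => v (2 * j + 1) (w (2 * j + 1) x) = v (2 * j + 1) (y j)

theorem wphMap_surjective (k : ℕ) (htop : ∀ i, k + 1 ≤ i → Subsingleton (E i))
    (hv : ∀ i, v (i + 1) ∘ₗ v i = 0)
    (hw : ∀ i (x : E i), v i (w i (v i x)) = v i x)
    (hp : ∀ i (x : ↥(LinearMap.ker (v i))), p i (x : E i) = cohQuot v i x)
    (him : ∀ i (η : Hcoh v i), v i (h i η) = 0)
    (hph : ∀ i (η : Hcoh v i), p i (h i η) = η) :
    Function.Surjective (wphMap v w p h) := by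
  have hvv : ∀ i (x : E i), v (i + 1) (v i x) = 0 := fun i x => LinearMap.congr_fun (hv i) x
  have hpv : ∀ i (x : E i), p (i + 1) (v i x) = 0 := fun i x =>
    (apply_eq_zero_iff_exists_of_cocycle v p hp i _ (hvv i x)).2 ⟨x, rfl⟩
  rintro ⟨y, ζ⟩
  have adjust : ∀ j (a : E (2 * j)), ∃ x, WphCompatible v w y j x ∧
      v (2 * j) x = v (2 * j) a ∧ p (2 * j) x = ζ j := fun j a => by
    obtain ⟨b, hb, hpb⟩ : ∃ b, v (2 * j) b = v (2 * j) a ∧ p (2 * j) b = ζ j :=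
      ⟨a + h (2 * j) (ζ j - p (2 * j) a), by rw [map_add, him, add_zero],
        by rw [map_add, hph, add_sub_cancel]⟩
    cases j with
    | zero => exact ⟨b, trivial, hb, hpb⟩
    | succ j =>
      refine ⟨b + v (2 * j + 1) (y j - w (2 * j + 1) b), ?_, ?_, ?_⟩
      · change v (2 * j + 1) (w (2 * j + 1) (b + v (2 * j + 1) (y j - w (2 * j + 1) b))) = _
        rw [map_add, map_add, hw, map_sub, add_sub_cancel]
      · rw [map_add]
        exact (congrArg _ (hvv (2 * j + 1) _)).trans ((add_zero _).trans hb)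
      · rw [map_add]
        exact (congrArg _ (hpv (2 * j + 1) _)).trans ((add_zero _).trans hpb)
  obtain ⟨x, hx⟩ := exists_forall_rel_succ_of_eventually_unique (k + 1)
    (X := fun j => {x : E (2 * j) // WphCompatible v w y j x})
    (fun j x x' => (∃ η, v (2 * j) x.1 + w (2 * j + 1) x'.1 + h (2 * j + 1) η = y j) ∧
      p (2 * j) x.1 = ζ j)
    (by
      rintro j ⟨x', hx'⟩
      replace hx' : v (2 * j + 1) (w (2 * j + 1) x') = v (2 * j + 1) (y j) := hx'
      set u := y j - w (2 * j + 1) x' with hu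
      have hvu : v (2 * j + 1) u = 0 := by rw [hu, map_sub, hx', sub_self]
      obtain ⟨a, ha⟩ := (apply_eq_zero_iff_exists_of_cocycle v p hp (2 * j)
        (u - h (2 * j + 1) (p (2 * j + 1) u)) (by rw [map_sub, him, hvu, sub_zero])).1
        (by rw [map_sub, hph, sub_self])
      obtain ⟨x, hx, hvx, hpx⟩ := adjust j a
      refine ⟨⟨x, hx⟩, ⟨p (2 * j + 1) u, ?_⟩, hpx⟩
      change v (2 * j) x + w (2 * j + 1) x' + _ = _
      rw [hvx, ha, hu]
      abel)
    (fun j hj => by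
      have := htop (2 * j) (by omega)
      obtain ⟨x, hx, -⟩ := adjust j 0
      exact ⟨inferInstance, ⟨⟨x, hx⟩⟩⟩)
  choose η hη using fun j => (hx j).1
  exact ⟨(fun j => (x j).1, η), Prod.ext (funext hη) (funext fun j => (hx j).2)⟩

end

/-- Given a complex `0 → E¹ → ⋯ → Eᵏ → 0` of finite-dimensional complex vector spaces
(`E⁰ = E^{k+1} = 0`) and a `(w,p,h)`-datum (here `w i`, `p i`, `h i` play the roles of
`w_{i+1}`, `p_i`, `h_i`), the map `v⁺ + w⁺ + p⁺ + h⁻ : E⁺ ⊕ H⁻ → E⁻ ⊕ H⁺`, sending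
`(x, η)` to `(fun j => v_{2j} x_{2j} + w_{2j+2} x_{2j+2} + h_{2j+1} η_{2j+1},
fun j => p_{2j} x_{2j})`, is a linear isomorphism. -/
theorem wph_datum_linear_isomorphism (k : ℕ) [∀ i, FiniteDimensional ℂ (E i)]
    (h0 : Subsingleton (E 0)) (htop : ∀ i, k + 1 ≤ i → Subsingleton (E i))
    (v : ∀ i, E i →ₗ[ℂ] E (i + 1)) (hv : ∀ i, v (i + 1) ∘ₗ v i = 0)
    (w : ∀ i, E (i + 1) →ₗ[ℂ] E i)
    (p : ∀ i, E i →ₗ[ℂ] Hcoh v i)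
    (h : ∀ i, Hcoh v i →ₗ[ℂ] E i)
    (hw : ∀ i (x : E i), v i (w i (v i x)) = v i x)
    (hp : ∀ i (x : ↥(LinearMap.ker (v i))), p i (x : E i) = cohQuot v i x)
    (him : ∀ i (η : Hcoh v i), v i (h i η) = 0)
    (hph : ∀ i (η : Hcoh v i), p i (h i η) = η) :
    ∃ Φ : ((∀ j : ℕ, E (2 * j)) × (∀ j : ℕ, Hcoh v (2 * j + 1))) ≃ₗ[ℂ]
        ((∀ j : ℕ, E (2 * j + 1)) × (∀ j : ℕ, Hcoh v (2 * j))),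
      ∀ (x : ∀ j : ℕ, E (2 * j)) (η : ∀ j : ℕ, Hcoh v (2 * j + 1)),
        Φ (x, η) =
          (fun j => v (2 * j) (x j) + w (2 * j + 1) (x (j + 1)) + h (2 * j + 1) (η j),
           fun j => p (2 * j) (x j)) := by
  exact ⟨LinearEquiv.ofBijective (wphMap v w p h)
    ⟨wphMap_injective v w p h k h0 htop hv hw hp him hph,
      wphMap_surjective v w p h k htop hv hw hp him hph⟩, fun _ _ => rfl⟩
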